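/- Let T be a tree with a vertex u that has two distinct neighbors v₁ and v₂, both of degree 1 in T. Then γ_e(T) ≤ γ_e(T − v₂), where T − v₂ is the tree obtained from T by deleting the vertex v₂. -/

import Mathlib

open SimpleGraph

/-- The contribution `(1/2)^(d-1)` of a vertex at `S`-restricted distance `d`,
with `(1/2)^∞ = 0`. -/
noncomputable def expStep (d : ℕ∞) : ℝ :=
  if h : d = ⊤ then 0 else (1 / 2 : ℝ) ^ ((d.untop h : ℤ) - 1)

/-- `expDist G S u v` is the minimum number of edges of a walk in `G` from `u` to `v`
such that `v` is the only vertex of the walk belonging to `S` (i.e. the distance from `u`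
to `v ∈ S` in `G - (S \ {v})`), and `⊤` if no such walk exists. -/
noncomputable def expDist {V : Type*} (G : SimpleGraph V) (S : Finset V) (u v : V) : ℕ∞ :=
  sInf {n : ℕ∞ | ∃ p : G.Walk u v, (∀ x ∈ p.support, x ∈ S → x = v) ∧ (p.length : ℕ∞) = n}

/-- The weight `w_{(G,S)}(u) = Σ_{v ∈ S} (1/2)^(dist_{(G,S)}(u,v) - 1)`. -/
noncomputable def expWeight {V : Type*} (G : SimpleGraph V) (S : Finset V) (u : V) : ℝ :=
  ∑ v ∈ S, expStep (expDist G S u v)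

/-- `S` is an exponential dominating set of `G`. -/
def IsExpDomSet {V : Type*} (G : SimpleGraph V) (S : Finset V) : Prop :=
  ∀ u : V, 1 ≤ expWeight G S u

/-- The exponential domination number of `G`. -/
noncomputable def expDomNum {V : Type*} (G : SimpleGraph V) : ℕ :=
  sInf {k : ℕ | ∃ S : Finset V, IsExpDomSet G S ∧ S.card = k}

lemma expStep_coe (n : ℕ) : expStep (n : ℕ∞) = 2 * (1 / 2 : ℝ) ^ n := by
  have h : (1 / 2 : ℝ) ≠ 0 := by norm_num
  have hn : expStep (n : ℕ∞) = (1 / 2 : ℝ) ^ ((n : ℤ) - 1) := by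
    rw [expStep, dif_neg (ENat.natCast_ne_top n)]
    rfl
  rw [hn, zpow_sub_one₀ h, zpow_natCast]
  norm_num [mul_comm]

lemma expStep_nonneg (d : ℕ∞) : 0 ≤ expStep d := by
  unfold expStep
  split_ifs <;> positivity

section

variable {V : Type*} {G : SimpleGraph V} {S : Finset V} {u v : V}

lemma le_expStep_expDist (p : G.Walk u v) (hp : ∀ x ∈ p.support, x ∈ S → x = v) :
    2 * (1 / 2 : ℝ) ^ p.length ≤ expStep (expDist G S u v) := by
  have hle : expDist G S u v ≤ p.length := sInf_le ⟨p, hp, rfl⟩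
  obtain ⟨n, hn⟩ := ENat.ne_top_iff_exists.1 (ne_top_of_le_ne_top (ENat.natCast_ne_top _) hle)
  rw [← hn] at hle ⊢
  rw [expStep_coe]
  have h : n ≤ p.length := by exact_mod_cast hle
  have := pow_le_pow_of_le_one (by norm_num : (0 : ℝ) ≤ 1 / 2) (by norm_num) h
  linarith

/-- A nonzero contribution is realised by a path. -/
lemma expStep_expDist_eq (G : SimpleGraph V) (S : Finset V) (u v : V) :
    expStep (expDist G S u v) = 0 ∨ ∃ p : G.Walk u v, p.IsPath ∧
      (∀ x ∈ p.support, x ∈ S → x = v) ∧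
      expStep (expDist G S u v) = 2 * (1 / 2 : ℝ) ^ p.length := by
  classical
  by_cases h : expDist G S u v = ⊤
  · left
    simp [h, expStep]
  right
  have hne : {n : ℕ∞ | ∃ p : G.Walk u v, (∀ x ∈ p.support, x ∈ S → x = v) ∧
      (p.length : ℕ∞) = n}.Nonempty := by
    by_contra hempty
    rw [Set.not_nonempty_iff_eq_empty] at hempty
    exact h (by rw [expDist, hempty, sInf_empty])
  obtain ⟨p, hp, hlen⟩ := csInf_mem hne
  have hb : ∀ x ∈ p.bypass.support, x ∈ S → x = v :=
    fun x hx => hp x (p.support_bypass_subset_support hx)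
  refine ⟨p.bypass, p.bypass_isPath, hb, le_antisymm ?_ (le_expStep_expDist _ hb)⟩
  have hd : expDist G S u v = p.length := hlen.symm
  rw [hd, expStep_coe]
  have := pow_le_pow_of_le_one (by norm_num : (0 : ℝ) ≤ 1 / 2) (by norm_num)
    p.length_bypass_le_length
  linarith

lemma expStep_expDist_le_one (huv : u ≠ v) : expStep (expDist G S u v) ≤ 1 := by
  obtain h | ⟨p, -, -, h⟩ := expStep_expDist_eq G S u v
  · rw [h]
    norm_num
  · rw [h]
    have hp : 1 ≤ p.length := by
      by_contra h0
      exact huv (Walk.eq_of_length_eq_zero (p := p) (by omega))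
    have := pow_le_pow_of_le_one (by norm_num : (0 : ℝ) ≤ 1 / 2) (by norm_num) hp
    linarith

lemma expStep_expDist_self : 1 ≤ expStep (expDist G S u u) := by
  have := le_expStep_expDist (S := S) (Walk.nil : G.Walk u u) (by simp)
  norm_num at this
  linarith

lemma one_le_expStep_expDist_of_adj (h : G.Adj u v) (hu : u ∉ S) :
    1 ≤ expStep (expDist G S u v) := by
  have := le_expStep_expDist (S := S) (Walk.cons h .nil) (by simp [hu])
  norm_num at this
  exact this

lemma expStep_expDist_le_expWeight (hv : v ∈ S) :
    expStep (expDist G S u v) ≤ expWeight G S u :=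
  Finset.single_le_sum (f := fun v => expStep (expDist G S u v))
    (fun _ _ => expStep_nonneg _) hv

lemma half_expStep_expDist_le_of_adj {y : V} (h : G.Adj v u) (hv : v ∉ S) :
    1 / 2 * expStep (expDist G S u y) ≤ expStep (expDist G S v y) := by
  obtain h0 | ⟨p, -, hp, hlen⟩ := expStep_expDist_eq G S u y
  · rw [h0, mul_zero]
    exact expStep_nonneg _
  · rw [hlen]
    have := le_expStep_expDist (S := S) (Walk.cons h p) (by
      intro x hx hxS
      rw [Walk.support_cons, List.mem_cons] at hx
      obtain rfl | hx := hx
      · exact (hv hxS).elim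
      · exact hp x hx hxS)
    rw [Walk.length_cons, pow_succ] at this
    linarith

lemma half_expWeight_le_of_adj (h : G.Adj v u) (hv : v ∉ S) :
    1 / 2 * expWeight G S u ≤ expWeight G S v := by
  rw [expWeight, expWeight, Finset.mul_sum]
  exact Finset.sum_le_sum fun y _ => half_expStep_expDist_le_of_adj h hv

/-- Any path through `u` splits into a path to `u` and a path from `u`. -/
lemma expStep_le_of_mem_support {S' : Finset V} {x y : V} [DecidableEq V]
    (hS : ∀ z ∈ S', z = u ∨ z ∈ S) (huy : u ≠ y) (p : G.Walk x y) (hpath : p.IsPath)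
    (hp : ∀ z ∈ p.support, z ∈ S → z = y) (hu : u ∈ p.support) :
    2 * (1 / 2 : ℝ) ^ p.length ≤
      1 / 2 * expStep (expDist G S' x u) * expStep (expDist G S u y) := by
  have h1 := le_expStep_expDist (S := S') (p.takeUntil u hu) (by
    intro z hz hzS
    obtain h | h := hS z hzS
    · exact h
    · obtain rfl := hp z (p.support_takeUntil_subset_support hu hz) h
      exact (Walk.endpoint_notMem_support_takeUntil hpath hu huy.symm hz).elim)
  have h2 := le_expStep_expDist (S := S) (p.dropUntil u hu)
    fun z hz => hp z (p.support_dropUntil_subset_support hu hz)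
  have hlen : p.length = (p.takeUntil u hu).length + (p.dropUntil u hu).length := by
    conv_lhs => rw [← p.take_spec hu, Walk.length_append]
  have := mul_le_mul h1 h2 (by positivity) (expStep_nonneg _)
  rw [hlen, pow_add]
  linarith

lemma expStep_expDist_le_add {S' : Finset V} {x y : V}
    (hS : ∀ z ∈ S', z = u ∨ z ∈ S) (huy : u ≠ y) :
    expStep (expDist G S x y) ≤ expStep (expDist G S' x y) +
      1 / 2 * expStep (expDist G S' x u) * expStep (expDist G S u y) := by
  classical
  have n1 := expStep_nonneg (expDist G S' x y)
  have n2 := mul_nonneg (mul_nonneg (by norm_num : (0 : ℝ) ≤ 1 / 2)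
    (expStep_nonneg (expDist G S' x u))) (expStep_nonneg (expDist G S u y))
  obtain h0 | ⟨p, hpath, hp, hlen⟩ := expStep_expDist_eq G S x y
  · linarith
  by_cases hu : u ∈ p.support
  · have := expStep_le_of_mem_support hS huy p hpath hp hu
    linarith
  · have := le_expStep_expDist (S := S') p (by
      intro z hz hzS
      obtain rfl | h := hS z hzS
      · exact (hu hz).elim
      · exact hp z hz h)
    linarith

lemma expStep_expDist_leaf_le {S' : Finset V} {x : V}
    (hS : ∀ z ∈ S', z = u ∨ z ∈ S) (huv : G.Adj u v) (hleaf : ∀ z, G.Adj v z → z = u)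
    (hxv : x ≠ v) :
    expStep (expDist G S x v) ≤ 1 / 2 * expStep (expDist G S' x u) := by
  classical
  have n1 := expStep_nonneg (expDist G S' x u)
  obtain h0 | ⟨p, hpath, hp, hlen⟩ := expStep_expDist_eq G S x v
  · linarith
  have hnil : ¬ p.Nil := fun h => hxv h.eq
  have hu : u ∈ p.support := by
    rw [← hleaf _ (p.adj_penultimate hnil).symm]
    exact p.getVert_mem_support _
  have h1 := expStep_le_of_mem_support hS huv.ne p hpath hp hu
  have h2 := mul_le_mul_of_nonneg_left (expStep_expDist_le_one (G := G) (S := S) huv.ne)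
    (mul_nonneg (by norm_num : (0 : ℝ) ≤ 1 / 2) n1)
  linarith

/-- A leaf outside `S` receives at most as much as any neighbor outside `S` of its support
vertex. -/
lemma expStep_expDist_leaf_le_twin {v' y : V} (hleaf : ∀ z, G.Adj v z → z = u)
    (hv' : G.Adj v' u) (hv'S : v' ∉ S) (hvy : v ≠ y) :
    expStep (expDist G S v y) ≤ expStep (expDist G S v' y) := by
  obtain h0 | ⟨p, -, hp, hlen⟩ := expStep_expDist_eq G S v y
  · rw [h0]
    exact expStep_nonneg _
  cases p with
  | nil => exact (hvy rfl).elim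
  | cons h q =>
    obtain rfl := hleaf _ h
    have := le_expStep_expDist (S := S) (Walk.cons hv' q) (by
      intro z hz hzS
      rw [Walk.support_cons, List.mem_cons] at hz
      obtain rfl | hz := hz
      · exact (hv'S hzS).elim
      · exact hp z (by simp [hz]) hzS)
    rw [hlen]
    exact this

lemma expWeight_induce_le (s : Set V) (S : Finset s) (x : s) :
    expWeight (G.induce s) S x ≤ expWeight G (S.map (Function.Embedding.subtype _)) x := by
  rw [expWeight, expWeight, Finset.sum_map]
  refine Finset.sum_le_sum fun y _ => ?_
  obtain h0 | ⟨p, -, hp, hlen⟩ := expStep_expDist_eq (G.induce s) S x y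
  · rw [h0]
    exact expStep_nonneg _
  · rw [hlen]
    have := le_expStep_expDist (S := S.map (Function.Embedding.subtype _))
      (p.map (Embedding.induce s).toHom) (by
        intro z hz hzS
        rw [Walk.support_map, List.mem_map] at hz
        obtain ⟨w, hw, rfl⟩ := hz
        obtain ⟨w', hw', hww⟩ := Finset.mem_map.1 hzS
        obtain rfl : w' = w := Subtype.ext hww
        rw [hp w' hw hw'])
    rw [Walk.length_map] at this
    exact this

lemma IsExpDomSet.expDomNum_le (h : IsExpDomSet G S) : expDomNum G ≤ S.card :=
  Nat.sInf_le ⟨S, h, rfl⟩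

lemma exists_isExpDomSet_card_eq [Fintype V] (G : SimpleGraph V) :
    ∃ S : Finset V, IsExpDomSet G S ∧ S.card = expDomNum G :=
  Nat.sInf_mem (s := {k : ℕ | ∃ S : Finset V, IsExpDomSet G S ∧ S.card = k})
    ⟨_, Finset.univ, fun u => expStep_expDist_self.trans
      (expStep_expDist_le_expWeight (Finset.mem_univ u)), rfl⟩

/-- If all vertices but a twin leaf are dominated, the dominating set can be modified to dominate
the twin leaf as well without increasing its size. -/
lemma expDomNum_le_card_of_twin_leaf [DecidableEq V] {v₁ v₂ : V} (hne : v₁ ≠ v₂)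
    (h1 : G.Adj u v₁) (h2 : G.Adj u v₂) (hleaf : ∀ z, G.Adj v₁ z → z = u)
    (hv₂ : v₂ ∉ S) (hS : ∀ x, x ≠ v₂ → 1 ≤ expWeight G S x) : expDomNum G ≤ S.card := by
  have key (h : 1 ≤ expWeight G S v₂) : expDomNum G ≤ S.card := by
    refine IsExpDomSet.expDomNum_le fun x => ?_
    obtain rfl | hx := eq_or_ne x v₂
    · exact h
    · exact hS x hx
  by_cases hv₁ : v₁ ∈ S
  swap
  · exact key <| (hS v₁ hne).trans <| Finset.sum_le_sum fun y hy =>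
      expStep_expDist_leaf_le_twin hleaf h2.symm hv₂ (by rintro rfl; exact hv₁ hy)
  by_cases hu : u ∈ S
  · exact key ((one_le_expStep_expDist_of_adj h2.symm hv₂).trans
      (expStep_expDist_le_expWeight hu))
  have hsplit (x : V) : expWeight G S x = expStep (expDist G S x v₁) +
      ∑ y ∈ S.erase v₁, expStep (expDist G S x y) := (Finset.add_sum_erase _ _ hv₁).symm
  by_cases hW : 1 ≤ ∑ y ∈ S.erase v₁, expStep (expDist G S u y)
  · refine key ?_
    have e1 := half_expWeight_le_of_adj h2.symm hv₂
    have e2 := hsplit u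
    have e3 := one_le_expStep_expDist_of_adj h1 hu
    linarith
  push Not at hW
  have hu' : u ∉ S.erase v₁ := fun h => hu (Finset.mem_of_mem_erase h)
  set S' := insert u (S.erase v₁) with hS'
  have huS' : u ∈ S' := Finset.mem_insert_self _ _
  have hsub : ∀ z ∈ S', z = u ∨ z ∈ S := fun z hz =>
    (Finset.mem_insert.1 hz).imp id Finset.mem_of_mem_erase
  have hcard : S'.card = S.card := by
    rw [hS', Finset.card_insert_of_notMem hu', Finset.card_erase_add_one hv₁]
  rw [← hcard]
  refine IsExpDomSet.expDomNum_le fun x => ?_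
  by_cases hx₁ : x = v₁
  · subst hx₁
    refine (one_le_expStep_expDist_of_adj h1.symm ?_).trans (expStep_expDist_le_expWeight huS')
    simp [hS', h1.ne']
  by_cases hx₂ : x = v₂
  · subst hx₂
    refine (one_le_expStep_expDist_of_adj h2.symm ?_).trans (expStep_expDist_le_expWeight huS')
    simp [hS', h2.ne', hv₂]
  have e1 := hS x hx₂
  have e2 := expStep_expDist_leaf_le hsub h1 hleaf hx₁
  have e3 : ∑ y ∈ S.erase v₁, expStep (expDist G S x y) ≤
      ∑ y ∈ S.erase v₁, expStep (expDist G S' x y) +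
        1 / 2 * expStep (expDist G S' x u) *
          ∑ y ∈ S.erase v₁, expStep (expDist G S u y) := by
    rw [Finset.mul_sum, ← Finset.sum_add_distrib]
    exact Finset.sum_le_sum fun y hy =>
      expStep_expDist_le_add hsub (by rintro rfl; exact hu' hy)
  have e4 := mul_le_mul_of_nonneg_left hW.le
    (mul_nonneg (by norm_num : (0 : ℝ) ≤ 1 / 2) (expStep_nonneg (expDist G S' x u)))
  have e5 : expWeight G S' x = expStep (expDist G S' x u) +
      ∑ y ∈ S.erase v₁, expStep (expDist G S' x y) := Finset.sum_insert hu'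
  have e6 := hsplit x
  linarith

end

/-- Lemma 7(i): if a vertex `u` of a tree `T` has two distinct neighbors `v₁` and
`v₂` of degree `1`, then `γ_e(T) ≤ γ_e(T - v₂)`. -/
theorem expDomNum_le_delete_twin_leaf {V : Type*} [Fintype V] [DecidableEq V]
    (T : SimpleGraph V) [DecidableRel T.Adj] (hT : T.IsTree) (u v₁ v₂ : V)
    (hne : v₁ ≠ v₂) (h1 : T.Adj u v₁) (h2 : T.Adj u v₂)
    (hd1 : T.degree v₁ = 1) (hd2 : T.degree v₂ = 1) :
    expDomNum T ≤ expDomNum (T.induce {x : V | x ≠ v₂}) := by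
  obtain ⟨S, hS, hcard⟩ := exists_isExpDomSet_card_eq (T.induce {x : V | x ≠ v₂})
  rw [← hcard, ← Finset.card_map (Function.Embedding.subtype _)]
  have hleaf : ∀ z, T.Adj v₁ z → z = u := fun z hz =>
    (degree_eq_one_iff_existsUnique_adj.1 hd1).unique hz h1.symm
  refine expDomNum_le_card_of_twin_leaf hne h1 h2 hleaf ?_ fun x hx =>
    (hS ⟨x, hx⟩).trans (expWeight_induce_le _ S ⟨x, hx⟩)
  intro h
  obtain ⟨w, -, hw⟩ := Finset.mem_map.1 h
  exact w.2 hw
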